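/- arXiv:2208.04058 — 9 statements merged into one kernel-verified Lean document; each statement's English description precedes it below -/
import Mathlib

section
/- Let G be a group and let H, K ≤ G be subgroups. Then the following are equivalent: (i) the double coset HK = {hk : h ∈ H, k ∈ K} is separable in G and the intersection H ∩ K is profinitely tractable in G; (ii) for every finite-index subgroup L ≤ G with H ∩ K ⊆ L, the set (H ∩ L)K = {hk : h ∈ H ∩ L, k ∈ K} is separable in G. -/
open Pointwise

/-- A subset `S` of a group `G` is *separable* (closed in the profinite topology) if for
every `g ∉ S` there is a finite-index normal subgroup `N ⊴ G` with `gN ∩ SN = ∅`,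
i.e. `g ∉ S·N`. -/
def ProfinitelyClosed {G : Type*} [Group G] (S : Set G) : Prop :=
  ∀ g : G, g ∉ S → ∃ N : Subgroup G, N.Normal ∧ N.FiniteIndex ∧ g ∉ S * (N : Set G)

/-- The intersection `H ∩ K` is *profinitely tractable* in `G` if for every finite-index
normal `M ⊴ G` there is a finite-index normal `N ⊴ G` with `N ⊆ M` and
`HN ∩ KN ⊆ (H ∩ K)M`. -/
def ProfinitelyTractable {G : Type*} [Group G] (H K : Subgroup G) : Prop :=
  ∀ M : Subgroup G, M.Normal → M.FiniteIndex →
    ∃ N : Subgroup G, N.Normal ∧ N.FiniteIndex ∧ (N : Set G) ⊆ (M : Set G) ∧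
      ((H : Set G) * (N : Set G)) ∩ ((K : Set G) * (N : Set G)) ⊆
        ((H ⊓ K : Subgroup G) : Set G) * (M : Set G)

theorem double_coset_separability_iff_tractable
    {G : Type*} [Group G] (H K : Subgroup G) :
    (ProfinitelyClosed ((H : Set G) * (K : Set G)) ∧ ProfinitelyTractable H K) ↔
      (∀ L : Subgroup G, L.FiniteIndex → H ⊓ K ≤ L →
        ProfinitelyClosed (((H ⊓ L : Subgroup G) : Set G) * (K : Set G))) := by
  constructor
  · rintro ⟨hc, ht⟩ L hL hKL g hg
    by_cases hgHK : g ∈ (H : Set G) * (K : Set G)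
    · obtain ⟨N, hN, hNf, hNM, hsub⟩ := ht L.normalCore inferInstance inferInstance
      refine ⟨N, hN, hNf, ?_⟩
      rintro ⟨a, ⟨h', hh', k', hk', rfl⟩, n, hn, e⟩
      obtain ⟨h, hh, k, hk, rfl⟩ := hgHK
      simp only [SetLike.mem_coe] at hh hk hh' hk' hn
      dsimp only at e hg
      have hh2 := Subgroup.mem_inf.1 hh'
      have key : h'⁻¹ * h ∈ ((H ⊓ K : Subgroup G) : Set G) * (L.normalCore : Set G) := by
        apply hsub
        refine ⟨⟨h'⁻¹ * h, H.mul_mem (H.inv_mem hh2.1) hh, 1, N.one_mem, by simp⟩,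
          ⟨k' * k⁻¹, K.mul_mem hk' (K.inv_mem hk), k * n * k⁻¹, hN.conj_mem n hn k, ?_⟩⟩
        have : h = h' * k' * n * k⁻¹ := by rw [e]; group
        rw [this]
        group
      obtain ⟨a, ha, m, hm, e2⟩ := key
      have h1 : h'⁻¹ * h ∈ L := by
        rw [← e2]
        exact L.mul_mem (hKL ha) (L.normalCore_le hm)
      have h2 : h ∈ L := by
        have := L.mul_mem hh2.2 h1
        simpa using this
      exact hg ⟨h, ⟨hh, h2⟩, k, hk, rfl⟩
    · obtain ⟨N, hN, hNf, hgN⟩ := hc g hgHK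
      refine ⟨N, hN, hNf, fun hmem => hgN ?_⟩
      refine Set.mul_subset_mul_right (Set.mul_subset_mul_right ?_) hmem
      exact fun x hx => hx.1
  · intro hall
    refine ⟨?_, ?_⟩
    · have := hall ⊤ inferInstance le_top
      simpa using this
    · intro M hM hMf
      set L : Subgroup G := (H ⊓ K) ⊔ M with hLdef
      have hML : M ≤ L := le_sup_right
      have hHKL : H ⊓ K ≤ L := le_sup_left
      have hLf : L.FiniteIndex := Subgroup.finiteIndex_of_le hML
      have hLc : (L : Set G) = ((H ⊓ K : Subgroup G) : Set G) * (M : Set G) :=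
        Subgroup.mul_normal _ _
      have hsep := hall L hLf hHKL
      have hq : ∀ q : G ⧸ L, ∃ N : Subgroup G, N.Normal ∧ N.FiniteIndex ∧
          ∀ h ∈ H, h ∉ L → (QuotientGroup.mk h⁻¹ : G ⧸ L) = q →
            h ∉ ((H ⊓ L : Subgroup G) : Set G) * (K : Set G) * (N : Set G) := by
        intro q
        by_cases hex : ∃ h₀ ∈ H, h₀ ∉ L ∧ (QuotientGroup.mk h₀⁻¹ : G ⧸ L) = q
        · obtain ⟨h₀, hh₀, hL₀, hq₀⟩ := hex
          have hn : h₀ ∉ ((H ⊓ L : Subgroup G) : Set G) * (K : Set G) := by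
            rintro ⟨a, ha, k, hk, e⟩
            dsimp only at e
            have ha' := Subgroup.mem_inf.1 ha
            have hkH : k ∈ H := by
              have : k = a⁻¹ * h₀ := by rw [← e]; group
              rw [this]
              exact H.mul_mem (H.inv_mem ha'.1) hh₀
            exact hL₀ (e ▸ L.mul_mem ha'.2 (hHKL ⟨hkH, hk⟩))
          obtain ⟨N, hN, hNf, hN0⟩ := hsep h₀ hn
          refine ⟨N, hN, hNf, ?_⟩
          rintro h hh hhL hhq ⟨_, ⟨a, ha, k, hk, rfl⟩, n, hn, e⟩
          dsimp only at e
          have ha' := Subgroup.mem_inf.1 ha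
          have h3 : h₀ * h⁻¹ ∈ L := by
            have := QuotientGroup.eq.1 (hq₀.trans hhq.symm)
            simpa using this
          have h4 : h₀ * h⁻¹ ∈ H := H.mul_mem hh₀ (H.inv_mem hh)
          refine hN0 ⟨_, ⟨h₀ * h⁻¹ * a, ⟨H.mul_mem h4 ha'.1, L.mul_mem h3 ha'.2⟩,
            k, hk, rfl⟩, n, hn, ?_⟩
          dsimp only
          rw [← e]
          group
        · exact ⟨⊤, inferInstance, inferInstance,
            fun h hh hhL hhq => absurd ⟨h, hh, hhL, hhq⟩ hex⟩
      choose N hN hNf hNs using hq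
      have : Finite (G ⧸ L) := Subgroup.finite_quotient_of_finiteIndex
      have hI : (⨅ q, N q).Normal := Subgroup.normal_iInf_normal hN
      have hIf : (⨅ q, N q).FiniteIndex := Subgroup.finiteIndex_iInf hNf
      refine ⟨M ⊓ ⨅ q, N q, inferInstance, inferInstance, fun x hx => hx.1, ?_⟩
      rintro x ⟨⟨h, hh, n, hn, rfl⟩, ⟨k, hk, n', hn', e⟩⟩
      dsimp only at e
      rw [← hLc]
      have hnm := Subgroup.mem_inf.1 hn
      refine L.mul_mem ?_ (hML hnm.1)
      by_contra hhL
      refine hNs _ h hh hhL rfl ⟨_, ⟨1, Subgroup.one_mem _, k, hk, rfl⟩, n' * n⁻¹, ?_, ?_⟩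
      · have := Subgroup.mul_mem _ (Subgroup.mem_inf.1 hn').2 (Subgroup.inv_mem _ hnm.2)
        exact Subgroup.mem_iInf.1 this _
      · dsimp only
        rw [one_mul, ← mul_assoc, e]
        group
end

section
/- Let p be a prime and let G be a group with subgroups H, K ≤ G. Then the following are equivalent: (i) the double coset HK = {hk : h ∈ H, k ∈ K} is p-separable in G and the intersection H ∩ K is pro-p tractable in G; (ii) for every subgroup L ≤ G that contains a normal subgroup N ⊴ G with G/N a finite p-group, and such that H ∩ K ⊆ L, the set (H ∩ L)K = {hk : h ∈ H ∩ L, k ∈ K} is p-separable in G. -/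
open Pointwise

/-- A normal subgroup `N ⊴ G` is *p-open* if the quotient `G / N` is a finite `p`-group. -/
def IsPOpen (p : ℕ) {G : Type*} [Group G] (N : Subgroup G) : Prop :=
  ∃ hN : N.Normal, N.FiniteIndex ∧ (letI := hN; IsPGroup p (G ⧸ N))

/-- A subset `S` of a group `G` is *p-separable* (closed in the pro-`p` topology) if for
every `g ∉ S` there is a `p`-open normal subgroup `N ⊴ G` with `gN ∩ SN = ∅`,
i.e. `g ∉ S·N`. -/
def PSeparable (p : ℕ) {G : Type*} [Group G] (S : Set G) : Prop :=
  ∀ g : G, g ∉ S → ∃ N : Subgroup G, IsPOpen p N ∧ g ∉ S * (N : Set G)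

/-- The intersection `H ∩ K` is *pro-p tractable* in `G` if for every `p`-open normal
`M ⊴ G` there is a `p`-open normal `N ⊴ G` with `N ⊆ M` and `HN ∩ KN ⊆ (H ∩ K)M`. -/
def ProPTractable (p : ℕ) {G : Type*} [Group G] (H K : Subgroup G) : Prop :=
  ∀ M : Subgroup G, IsPOpen p M →
    ∃ N : Subgroup G, IsPOpen p N ∧ (N : Set G) ⊆ (M : Set G) ∧
      ((H : Set G) * (N : Set G)) ∩ ((K : Set G) * (N : Set G)) ⊆
        ((H ⊓ K : Subgroup G) : Set G) * (M : Set G)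

theorem isPOpen_iff_aux (p : ℕ) {G : Type*} [Group G] (N : Subgroup G) :
    IsPOpen p N ↔ N.Normal ∧ N.FiniteIndex ∧ ∀ g : G, ∃ k : ℕ, g ^ (p ^ k) ∈ N := by
  constructor
  · rintro ⟨hN, hf, hpg⟩
    refine ⟨hN, hf, fun g => ?_⟩
    obtain ⟨k, hk⟩ := hpg (QuotientGroup.mk g)
    refine ⟨k, ?_⟩
    rw [← QuotientGroup.mk_pow] at hk
    exact (QuotientGroup.eq_one_iff _).1 hk
  · rintro ⟨hN, hf, hpg⟩
    refine ⟨hN, hf, fun x => ?_⟩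
    obtain ⟨g, rfl⟩ := QuotientGroup.mk_surjective x
    obtain ⟨k, hk⟩ := hpg g
    refine ⟨k, ?_⟩
    rw [← QuotientGroup.mk_pow]
    exact (QuotientGroup.eq_one_iff _).2 hk

theorem isPOpen_top_aux (p : ℕ) {G : Type*} [Group G] : IsPOpen p (⊤ : Subgroup G) := by
  rw [isPOpen_iff_aux]
  exact ⟨inferInstance, inferInstance, fun g => ⟨0, trivial⟩⟩

theorem isPOpen_inf_aux (p : ℕ) {G : Type*} [Group G] {M N : Subgroup G}
    (hM : IsPOpen p M) (hN : IsPOpen p N) : IsPOpen p (M ⊓ N) := by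
  rw [isPOpen_iff_aux] at *
  obtain ⟨h1, h2, h3⟩ := hM
  obtain ⟨h4, h5, h6⟩ := hN
  refine ⟨inferInstance, inferInstance, fun g => ?_⟩
  obtain ⟨a, ha⟩ := h3 g
  obtain ⟨b, hb⟩ := h6 g
  refine ⟨a + b, ?_, ?_⟩
  · rw [pow_add, pow_mul]; exact M.pow_mem ha _
  · rw [pow_add, mul_comm, pow_mul]; exact N.pow_mem hb _

theorem isPOpen_finset_aux (p : ℕ) {G ι : Type*} [Group G] (f : ι → Subgroup G)
    (hf : ∀ i, IsPOpen p (f i)) (s : Finset ι) :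
    ∃ N : Subgroup G, IsPOpen p N ∧ ∀ i ∈ s, N ≤ f i := by
  classical
  induction s using Finset.induction_on with
  | empty => exact ⟨⊤, isPOpen_top_aux p, by simp⟩
  | insert a s _ ih =>
    obtain ⟨N, hN, h⟩ := ih
    refine ⟨f a ⊓ N, isPOpen_inf_aux p (hf a) hN, fun i hi => ?_⟩
    rcases Finset.mem_insert.1 hi with rfl | hi
    · exact inf_le_left
    · exact inf_le_right.trans (h i hi)

theorem double_coset_p_separability_iff_pro_p_tractable
    {p : ℕ} (hp : p.Prime) {G : Type*} [Group G] (H K : Subgroup G) :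
    (PSeparable p ((H : Set G) * (K : Set G)) ∧ ProPTractable p H K) ↔
      (∀ L : Subgroup G, (∃ N : Subgroup G, IsPOpen p N ∧ N ≤ L) → H ⊓ K ≤ L →
        PSeparable p (((H ⊓ L : Subgroup G) : Set G) * (K : Set G))) := by
  constructor
  · rintro ⟨hsep, htr⟩ L ⟨N₀, hN₀, hN₀L⟩ hL g hg
    by_cases hgHK : g ∈ (H : Set G) * (K : Set G)
    · obtain ⟨h, hh, k, hk, rfl⟩ := hgHK
      obtain ⟨N, hN, hNN₀, hsub⟩ := htr N₀ hN₀
      refine ⟨N, hN, ?_⟩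
      rintro ⟨_, ⟨l, hl, k', hk', rfl⟩, n, hn, heq⟩
      simp only at heq
      apply hg
      have hnorm : N.Normal := hN.1
      have hmem : l⁻¹ * h ∈ ((H ⊓ K : Subgroup G) : Set G) * (N₀ : Set G) := by
        apply hsub
        refine ⟨⟨l⁻¹ * h, H.mul_mem (H.inv_mem hl.1) hh, 1, N.one_mem, by simp⟩, ?_⟩
        refine ⟨k' * k⁻¹, K.mul_mem hk' (K.inv_mem hk), k * n * k⁻¹,
          hnorm.conj_mem n hn k, ?_⟩
        have : h = l * k' * n * k⁻¹ := by rw [heq]; group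
        rw [this]; simp only; group
      obtain ⟨a, ha, m, hm, ham⟩ := hmem
      have h1 : l⁻¹ * h ∈ L := by
        rw [← ham]; exact L.mul_mem (hL ha) (hN₀L hm)
      have h2 : h ∈ L := by
        have := L.mul_mem hl.2 h1
        simpa using this
      exact ⟨h, ⟨hh, h2⟩, k, hk, rfl⟩
    · obtain ⟨N, hN, hgN⟩ := hsep g hgHK
      refine ⟨N, hN, fun hc => hgN ?_⟩
      exact Set.mul_subset_mul_right (Set.mul_subset_mul_right (fun x hx => hx.1)) hc
  · intro hall
    constructor
    · have := hall ⊤ ⟨⊤, isPOpen_top_aux p, le_rfl⟩ le_top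
      simpa using this
    · intro M hM
      have hMn : M.Normal := hM.1
      have hMf : M.FiniteIndex := hM.2.1
      have hsep := hall ((H ⊓ K) ⊔ M) ⟨M, hM, le_sup_right⟩ le_sup_left
      set L : Subgroup G := (H ⊓ K) ⊔ M with hLdef
      have key : ∀ q : G ⧸ M, ∃ N : Subgroup G, IsPOpen p N ∧
          ∀ h ∈ H, h ∉ L → (QuotientGroup.mk h : G ⧸ M) = q →
            h ∉ (K : Set G) * (N : Set G) := by
        intro q
        by_cases hq : ∃ h ∈ H, h ∉ L ∧ (QuotientGroup.mk h : G ⧸ M) = q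
        · obtain ⟨h, hh, hhL, rfl⟩ := hq
          have hnot : h ∉ ((H ⊓ L : Subgroup G) : Set G) * (K : Set G) := by
            rintro ⟨l, hl, k, hk, heq⟩
            simp only at heq
            apply hhL
            have hk2 : k ∈ H := by
              have : k = l⁻¹ * h := by rw [← heq]; group
              rw [this]; exact H.mul_mem (H.inv_mem hl.1) hh
            rw [← heq]
            exact L.mul_mem hl.2 ((le_sup_left : H ⊓ K ≤ L) ⟨hk2, hk⟩)
          obtain ⟨N, hN, hhN⟩ := hsep h hnot
          refine ⟨N, hN, ?_⟩
          rintro h' hh' _ hq ⟨k, hk, n, hn, heq⟩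
          simp only at heq
          apply hhN
          have hm : h'⁻¹ * h ∈ M := QuotientGroup.eq.1 hq
          have hm' : h * h'⁻¹ ∈ M := hMn.mem_comm hm
          refine ⟨h * h'⁻¹ * k, ⟨h * h'⁻¹, ⟨H.mul_mem hh (H.inv_mem hh'),
            (le_sup_right : M ≤ L) hm'⟩, k, hk, rfl⟩, n, hn, ?_⟩
          simp only
          rw [mul_assoc, heq]; group
        · exact ⟨⊤, isPOpen_top_aux p, fun h hh hhL hhq => (hq ⟨h, hh, hhL, hhq⟩).elim⟩
      choose f hf hfk using key
      haveI : Fintype (G ⧸ M) := Fintype.ofFinite _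
      obtain ⟨N, hN, hNf⟩ := isPOpen_finset_aux p f hf Finset.univ
      refine ⟨M ⊓ N, isPOpen_inf_aux p hM hN, fun x hx => hx.1, ?_⟩
      rintro x ⟨⟨h, hh, n, hn, rfl⟩, ⟨k, hk, n', hn', heq⟩⟩
      simp only at heq
      rw [← Subgroup.mul_normal]
      by_cases hhL : h ∈ L
      · exact L.mul_mem hhL ((le_sup_right : M ≤ L) hn.1)
      · refine (hfk (QuotientGroup.mk h) h hh hhL rfl ⟨k, hk, n' * n⁻¹, ?_, ?_⟩).elim
        · exact hNf _ (Finset.mem_univ _) (N.mul_mem hn'.2 (N.inv_mem hn.2))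
        · simp only
          rw [← mul_assoc, heq]; group
end

section
/- Let G be a group and let H, K ≤ G be subgroups. Then the following are equivalent: (i) the double coset HK is separable in G and the intersection H ∩ K is profinitely tractable in G; (iv) for all finite-index subgroups L₁, L₂ ≤ G such that (H ∩ L₁) ∩ (K ∩ L₂) = H ∩ K, the set (H ∩ L₁)(K ∩ L₂) = {hk : h ∈ H ∩ L₁, k ∈ K ∩ L₂} is separable in G. -/
open Pointwise

theorem double_coset_separability_iff_pairs_of_finite_index_subgroups
    {G : Type*} [Group G] (H K : Subgroup G) :
    (ProfinitelyClosed ((H : Set G) * (K : Set G)) ∧ ProfinitelyTractable H K) ↔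
      (∀ L₁ L₂ : Subgroup G, L₁.FiniteIndex → L₂.FiniteIndex →
        (H ⊓ L₁) ⊓ (K ⊓ L₂) = H ⊓ K →
        ProfinitelyClosed (((H ⊓ L₁ : Subgroup G) : Set G) * ((K ⊓ L₂ : Subgroup G) : Set G))) := by
  constructor
  · rintro ⟨hc, ht⟩ L₁ L₂ h1 h2 hD g hg
    have hD1 : H ⊓ K ≤ L₁ := hD ▸ (inf_le_left.trans inf_le_right)
    have hD2 : H ⊓ K ≤ L₂ := hD ▸ (inf_le_right.trans inf_le_right)
    by_cases hgc : g ∈ (H : Set G) * (K : Set G)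
    · obtain ⟨h, hh, k, hk, rfl⟩ := hgc
      obtain ⟨N, hN, hNf, hNM, hsub⟩ := ht (L₁ ⊓ L₂).normalCore inferInstance inferInstance
      refine ⟨N, hN, hNf, ?_⟩
      rintro ⟨_, ⟨a, ha, b, hb, rfl⟩, n, hn, he⟩
      have he : a * b * n = h * k := he
      have hMle := Subgroup.normalCore_le (L₁ ⊓ L₂)
      have ha' : a ∈ H ∧ a ∈ L₁ := ha
      have hb' : b ∈ K ∧ b ∈ L₂ := hb
      have hn' : k * n * k⁻¹ ∈ N := hN.conj_mem n hn k
      have hx : a⁻¹ * h = b * k⁻¹ * (k * n * k⁻¹) := by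
        have : h = a * b * n * k⁻¹ := by rw [he]; group
        rw [this]; group
      obtain ⟨d, hd, m, hm, hdm⟩ := hsub (a := a⁻¹ * h)
        ⟨⟨a⁻¹ * h, H.mul_mem (H.inv_mem ha'.1) hh, 1, N.one_mem, mul_one _⟩,
         ⟨b * k⁻¹, K.mul_mem hb'.1 (K.inv_mem hk), _, hn', hx.symm⟩⟩
      have hdm : d * m = a⁻¹ * h := hdm
      have hm' := hMle hm
      have q1 : a⁻¹ * h ∈ L₁ := hdm ▸ L₁.mul_mem (hD1 hd) hm'.1
      have q2 : a⁻¹ * h ∈ L₂ := hdm ▸ L₂.mul_mem (hD2 hd) hm'.2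
      rw [hx, L₂.mul_mem_cancel_right (hMle (hNM hn')).2,
        L₂.mul_mem_cancel_left hb'.2, L₂.inv_mem_iff] at q2
      rw [L₁.mul_mem_cancel_left (L₁.inv_mem ha'.2)] at q1
      exact hg ⟨h, ⟨hh, q1⟩, k, ⟨hk, q2⟩, rfl⟩
    · obtain ⟨N, hN, hNf, hgN⟩ := hc g hgc
      exact ⟨N, hN, hNf, fun h => hgN (Set.mul_subset_mul_right
        (Set.mul_subset_mul (fun _ h => h.1) (fun _ h => h.1)) h)⟩
  · intro hyp
    refine ⟨by simpa using hyp ⊤ ⊤ inferInstance inferInstance (by simp), ?_⟩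
    intro M hM hMf
    set L : Subgroup G := (H ⊓ K) ⊔ M with hL
    have hML : M ≤ L := le_sup_right
    have hDL : H ⊓ K ≤ L := le_sup_left
    have hLf : L.FiniteIndex := Subgroup.finiteIndex_of_le hML
    have hcl := hyp L ⊤ hLf inferInstance (by
      rw [inf_top_eq, inf_right_comm]; exact inf_eq_left.2 hDL)
    rw [inf_top_eq] at hcl
    have key : ∀ q : G ⧸ M, ∃ N : Subgroup G, N.Normal ∧ N.FiniteIndex ∧
        ∀ h ∈ H, (h : G ⧸ M) = q → h ∉ L →
          h ∉ (((H ⊓ L : Subgroup G) : Set G) * (K : Set G)) * (N : Set G) := by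
      intro q
      by_cases hq : ∃ h ∈ H, (h : G ⧸ M) = q ∧ h ∉ L
      · obtain ⟨h₀, hh₀, hq₀, hL₀⟩ := hq
        obtain ⟨N, hN, hNf, hno⟩ := hcl h₀ (by
          rintro ⟨a, ha, k, hk, rfl⟩
          have ha' : a ∈ H ∧ a ∈ L := ha
          exact hL₀ (L.mul_mem ha'.2 (hDL ⟨(H.mul_mem_cancel_left ha'.1).1 hh₀, hk⟩)))
        refine ⟨N, hN, hNf, fun h hh hhq _ => ?_⟩
        rintro ⟨_, ⟨a, ha, b, hb, rfl⟩, n, hn, he⟩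
        have he : a * b * n = h := he
        have ha' : a ∈ H ∧ a ∈ L := ha
        have hm : h₀ * h⁻¹ ∈ M := by
          rw [← QuotientGroup.eq_one_iff, QuotientGroup.mk_mul, QuotientGroup.mk_inv, hhq, hq₀,
            mul_inv_cancel]
        refine hno ⟨(h₀ * h⁻¹ * a) * b, ⟨h₀ * h⁻¹ * a,
          ⟨H.mul_mem (H.mul_mem hh₀ (H.inv_mem hh)) ha'.1, L.mul_mem (hML hm) ha'.2⟩,
          b, hb, rfl⟩, n, hn, ?_⟩
        change h₀ * h⁻¹ * a * b * n = h₀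
        rw [← he]; group
      · push Not at hq
        exact ⟨⊤, inferInstance, inferInstance, fun h hh hhq hhL => absurd (hq h hh hhq) hhL⟩
    choose N hN hNf hno using key
    have : Finite (G ⧸ M) := Subgroup.finite_quotient_of_finiteIndex
    have hIf : (⨅ q, N q).FiniteIndex := Subgroup.finiteIndex_iInf hNf
    have hIn : (⨅ q, N q).Normal := Subgroup.normal_iInf_normal hN
    refine ⟨(⨅ q, N q) ⊓ M, inferInstance, inferInstance, fun _ h => h.2, ?_⟩
    rintro x ⟨⟨h, hh, n, hn, hx⟩, ⟨k, hk, n', hn', hx'⟩⟩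
    have hx : h * n = x := hx
    have hx' : k * n' = x := hx'
    rw [← Subgroup.mul_normal, ← hL]
    by_cases hhL : h ∈ L
    · exact hx ▸ L.mul_mem hhL (hML hn.2)
    · exfalso
      refine hno (h : G ⧸ M) h hh rfl hhL ⟨1 * k, ⟨1, one_mem _, k, hk, rfl⟩, n' * n⁻¹, ?_, ?_⟩
      · exact mul_mem ((Subgroup.mem_iInf.1 hn'.1) _) (inv_mem ((Subgroup.mem_iInf.1 hn.1) _))
      · change 1 * k * (n' * n⁻¹) = h
        rw [one_mul, ← mul_assoc, hx', ← hx]; group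
end

section
/- Let G be a group and let H', H, K', K ≤ G be subgroups with H' ≤ H, K' ≤ K and H ∩ K ⊆ H'. Then, as subsets of G, (H'K) ∩ (HK') = H'K', where H'K = {hk : h ∈ H', k ∈ K} and similarly for the other products. -/
open Pointwise

theorem inter_of_double_cosets
    {G : Type*} [Group G] (H' H K' K : Subgroup G)
    (hH : H' ≤ H) (hK : K' ≤ K) (hHK : H ⊓ K ≤ H') :
    ((H' : Set G) * (K : Set G)) ∩ ((H : Set G) * (K' : Set G)) =
      (H' : Set G) * (K' : Set G) := by
  ext x
  constructor
  · rintro ⟨⟨a, ha, k, hk, hak⟩, ⟨h, hh, b, hb, hhb⟩⟩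
    have e : a * k = h * b := hak.trans hhb.symm
    have e2 : h⁻¹ * a = b * k⁻¹ := by
      rw [inv_mul_eq_iff_eq_mul, ← mul_assoc, ← e, mul_inv_cancel_right]
    have m : h⁻¹ * a ∈ H' := hHK ⟨H.mul_mem (H.inv_mem hh) (hH ha), by
      rw [e2]
      exact K.mul_mem (hK hb) (K.inv_mem hk)⟩
    have m2 : h ∈ H' := by
      have := H'.mul_mem ha (H'.inv_mem m)
      simpa using this
    exact ⟨h, m2, b, hb, hhb⟩
  · rintro ⟨a, ha, b, hb, hab⟩
    exact ⟨⟨a, ha, b, hK hb, hab⟩, ⟨a, hH ha, b, hb, hab⟩⟩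
end

section
/- Let G be a group, let H', H, K ≤ G be subgroups with H' ≤ H, and let N ⊴ G be a normal subgroup. If H ∩ KN ⊆ H', then, as subsets of G, H'K = (HK) ∩ (H'KN), where KN = {kn : k ∈ K, n ∈ N} and the other products are set products defined analogously. -/
open Pointwise

theorem double_coset_eq_inter_of_normal
    {G : Type*} [Group G] (H' H K N : Subgroup G)
    (hH : H' ≤ H) (hN : N.Normal)
    (h : (H : Set G) ∩ ((K : Set G) * (N : Set G)) ⊆ (H' : Set G)) :
    (H' : Set G) * (K : Set G) =
      ((H : Set G) * (K : Set G)) ∩ ((H' : Set G) * (K : Set G) * (N : Set G)) := by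
  apply Set.Subset.antisymm
  · rintro x ⟨a, ha, k, hk, rfl⟩
    exact ⟨⟨a, hH ha, k, hk, rfl⟩, ⟨a * k, ⟨a, ha, k, hk, rfl⟩, 1, N.one_mem, mul_one _⟩⟩
  · rintro x ⟨⟨a, ha, k, hk, rfl⟩, ⟨y, ⟨b, hb, k₁, hk₁, rfl⟩, n, hn, e⟩⟩
    have e' : b * k₁ * n = a * k := e
    have key : b⁻¹ * a ∈ H' := by
      apply h
      refine ⟨H.mul_mem (H.inv_mem (hH hb)) ha, k₁ * k⁻¹, K.mul_mem hk₁ (K.inv_mem hk),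
        k * n * k⁻¹, hN.conj_mem n hn k, ?_⟩
      have ha' : a = b * k₁ * n * k⁻¹ := by rw [e']; group
      show k₁ * k⁻¹ * (k * n * k⁻¹) = b⁻¹ * a
      rw [ha']; group
    refine ⟨a, ?_, k, hk, rfl⟩
    have := H'.mul_mem hb key
    rwa [mul_inv_cancel_left] at this
end

section
/- Let G be a group in which the double coset HK = {hk : h ∈ H, k ∈ K} is separable for every pair of finitely generated subgroups H, K ≤ G (i.e., G is double coset separable). Then for every pair of finitely generated subgroups H, K ≤ G, the intersection H ∩ K is profinitely tractable in G. -/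
open Pointwise

/-- Every double coset separable group satisfies the Wilson–Zalesskii property:
the intersection of any two finitely generated subgroups is profinitely tractable. -/
theorem double_coset_separable_implies_wilson_zalesskii
    {G : Type*} [Group G]
    (hdcs : ∀ H K : Subgroup G, H.FG → K.FG →
      ProfinitelyClosed ((H : Set G) * (K : Set G))) :
    ∀ H K : Subgroup G, H.FG → K.FG → ProfinitelyTractable H K := by
  intro H K hH hK M hMn hMf
  have hL : (H ⊓ M).FG := by
    have : Group.FG H := (Group.fg_iff_subgroup_fg H).2 hH
    have h1 : Group.FG (M.subgroupOf H) := inferInstance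
    have h2 : (M.subgroupOf H).FG := (Group.fg_iff_subgroup_fg _).1 h1
    have h3 : ((M.subgroupOf H).map H.subtype).FG := by
      classical
      obtain ⟨S, hS⟩ := h2
      refine ⟨S.image H.subtype, ?_⟩
      rw [Finset.coe_image, ← MonoidHom.map_closure, hS]
    rw [Subgroup.subgroupOf_map_subtype] at h3
    rwa [inf_comm]
  have hclosed := hdcs K (H ⊓ M) hK hL
  have key : ∀ q : G ⧸ M, ∃ N : Subgroup G, N.Normal ∧ N.FiniteIndex ∧
      ∀ h ∈ H, (QuotientGroup.mk h : G ⧸ M) = q → ∀ k ∈ K, ∀ n ∈ N, h = k * n →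
        h ∈ (K : Set G) * ((H ⊓ M : Subgroup G) : Set G) := by
    intro q
    by_cases hq : ∃ h0 ∈ H, (QuotientGroup.mk h0 : G ⧸ M) = q ∧
        h0 ∉ (K : Set G) * ((H ⊓ M : Subgroup G) : Set G)
    · obtain ⟨h0, hh0, rfl, hnot⟩ := hq
      obtain ⟨N, hN, hNf, hNot⟩ := hclosed h0 hnot
      refine ⟨N, hN, hNf, ?_⟩
      intro h hh hmk k hk n hn hkn
      exfalso
      apply hNot
      have hM : h⁻¹ * h0 ∈ M := QuotientGroup.eq.1 hmk
      refine ⟨k * (h⁻¹ * h0), ⟨k, hk, _, ⟨H.mul_mem (H.inv_mem hh) hh0, hM⟩, rfl⟩,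
        (h⁻¹ * h0)⁻¹ * n * (h⁻¹ * h0), ?_, ?_⟩
      · have := hN.conj_mem n hn (h⁻¹ * h0)⁻¹
        rwa [inv_inv] at this
      · subst hkn
        group
    · refine ⟨⊤, inferInstance, inferInstance, ?_⟩
      intro h hh hmk _ _ _ _ _
      by_contra hc
      exact hq ⟨h, hh, hmk, hc⟩
  choose N hNn hNf hN using key
  have : Finite (G ⧸ M) := inferInstance
  have hle : M ⊓ ⨅ q, N q ≤ M := inf_le_left
  refine ⟨M ⊓ ⨅ q, N q, ?_, ?_, hle, ?_⟩
  · have := Subgroup.normal_iInf_normal hNn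
    infer_instance
  · have : (⨅ q, N q).FiniteIndex := Subgroup.finiteIndex_iInf hNf
    infer_instance
  · rintro g ⟨⟨h, hh, n, hn, rfl⟩, ⟨k, hk, n', hn', he⟩⟩
    have he' : k * n' = h * n := he
    have hmem : n' * n⁻¹ ∈ N (QuotientGroup.mk h) := by
      have h1 := (M ⊓ ⨅ q, N q).mul_mem hn' ((M ⊓ ⨅ q, N q).inv_mem hn)
      exact (Subgroup.mem_iInf.1 h1.2) _
    obtain ⟨k', hk', l, hl, hkl⟩ := hN _ h hh rfl k hk _ hmem (by
      rw [← mul_assoc, he', mul_inv_cancel_right])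
    have hkl' : k' * l = h := hkl
    refine ⟨k', ⟨?_, hk'⟩, l * n, M.mul_mem hl.2 (hle hn), ?_⟩
    · have : k' = h * l⁻¹ := by rw [← hkl', mul_inv_cancel_right]
      rw [this]
      exact H.mul_mem hh (H.inv_mem hl.1)
    · change k' * (l * n) = h * n
      rw [← mul_assoc, hkl']
end

section
/- Let A = M₂(ℤ) be the additive group of 2×2 integer matrices, let SL₂(ℤ) act on A by left matrix multiplication, and let G = A ⋊ SL₂(ℤ) be the corresponding semidirect product. Let X ⊆ A be a subset such that for every a ∈ A \ X there exists a positive integer m with (a + M₂(mℤ)) ∩ X = ∅, where M₂(mℤ) is the subgroup of matrices all of whose entries are divisible by m. Then the set {(a, h) ∈ G : a ∈ X, h ∈ SL₂(ℤ)} is separable in G. -/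
open Pointwise

/-- The additive group of 2×2 integer matrices. -/
abbrev Mat : Type := Matrix (Fin 2) (Fin 2) ℤ

/-- The group SL₂(ℤ). -/
abbrev SL2 : Type := Matrix.SpecialLinearGroup (Fin 2) ℤ

/-- Left multiplication by `g ∈ SL₂(ℤ)` as an additive automorphism of `M₂(ℤ)`. -/
def leftMulAddAut (g : SL2) : AddAut Mat where
  toFun a := (g : Mat) * a
  invFun a := ((g⁻¹ : SL2) : Mat) * a
  left_inv a := by
    show ((g⁻¹ : SL2) : Mat) * ((g : Mat) * a) = a
    rw [← mul_assoc, ← Matrix.SpecialLinearGroup.coe_mul, inv_mul_cancel,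
      Matrix.SpecialLinearGroup.coe_one, one_mul]
  right_inv a := by
    show (g : Mat) * (((g⁻¹ : SL2) : Mat) * a) = a
    rw [← mul_assoc, ← Matrix.SpecialLinearGroup.coe_mul, mul_inv_cancel,
      Matrix.SpecialLinearGroup.coe_one, one_mul]
  map_add' a b := mul_add _ _ _

/-- The action of `SL₂(ℤ)` on `M₂(ℤ)` (written multiplicatively) by left multiplication. -/
def leftMulAction : SL2 →* MulAut (Multiplicative Mat) where
  toFun g := AddEquiv.toMultiplicative (leftMulAddAut g)
  map_one' := by ext a; simp [leftMulAddAut]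
  map_mul' g h := by ext a; simp [leftMulAddAut, mul_assoc]

/-- The semidirect product `G = M₂(ℤ) ⋊ SL₂(ℤ)`. -/
abbrev Gp : Type := SemidirectProduct (Multiplicative Mat) SL2 leftMulAction

/-- The subgroup `H = {(0, h) : h ∈ SL₂(ℤ)}` of `G`. -/
def Hsub : Subgroup Gp := (SemidirectProduct.inr (φ := leftMulAction)).range

/-- The element `i = (I, 1) ∈ G`, where `I` is the identity matrix. -/
def iElt : Gp := ⟨Multiplicative.ofAdd (1 : Mat), 1⟩

/-- The subgroup `K = iHi⁻¹ ≤ G`. -/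
def Ksub : Subgroup Gp := Hsub.map (MulAut.conj iElt).toMonoidHom

/-- The affine action of `G` on `M₂(ℤ/m)`: the pair `(a, h)` sends `v` to `a + h v`. -/
def affineEnd (m : ℕ) : Gp →* Function.End (Matrix (Fin 2) (Fin 2) (ZMod m)) where
  toFun x := fun v => (Multiplicative.toAdd x.left).map (Int.castRingHom (ZMod m)) +
    (x.right : Mat).map (Int.castRingHom (ZMod m)) * v
  map_one' := by
    funext v
    show (0 : Mat).map (Int.castRingHom (ZMod m)) +
      (1 : Mat).map (Int.castRingHom (ZMod m)) * v = v
    simp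
  map_mul' x y := by
    funext v
    show ((Multiplicative.toAdd x.left) + (x.right : Mat) * (Multiplicative.toAdd y.left)).map
        (Int.castRingHom (ZMod m)) +
      ((x.right * y.right : SL2) : Mat).map (Int.castRingHom (ZMod m)) * v =
      (Multiplicative.toAdd x.left).map (Int.castRingHom (ZMod m)) +
        (x.right : Mat).map (Int.castRingHom (ZMod m)) *
        ((Multiplicative.toAdd y.left).map (Int.castRingHom (ZMod m)) +
          (y.right : Mat).map (Int.castRingHom (ZMod m)) * v)
    rw [Matrix.SpecialLinearGroup.coe_mul, Matrix.map_add _ (map_add _), Matrix.map_mul,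
      Matrix.map_mul, mul_add, add_assoc, mul_assoc]

/-- If `X ⊆ M₂(ℤ)` is closed in the profinite (congruence) topology on the additive
group `M₂(ℤ)`, then the set `{(a, h) ∈ G : a ∈ X, h ∈ SL₂(ℤ)}` is separable in the
semidirect product `G = M₂(ℤ) ⋊ SL₂(ℤ)`. -/
theorem profinitelyClosed_of_congruence_closed (X : Set Mat)
    (hX : ∀ a : Mat, a ∉ X → ∃ m : ℕ, 0 < m ∧
      ∀ b : Mat, (∀ i j, (m : ℤ) ∣ (b - a) i j) → b ∉ X) :
    ProfinitelyClosed {x : Gp | Multiplicative.toAdd x.left ∈ X} := by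
  intro g hg
  obtain ⟨m, hm, h⟩ := hX _ hg
  have : NeZero m := ⟨hm.ne'⟩
  refine ⟨(affineEnd m).toHomPerm.ker, inferInstance, inferInstance, ?_⟩
  rintro ⟨s, hs, n, hn, rfl⟩
  refine h _ ?_ hs
  have h1 : (affineEnd m).toHomPerm n = 1 := hn
  have h2 : (affineEnd m).toHomPerm (s * n) = (affineEnd m).toHomPerm s := by
    rw [map_mul, h1, mul_one]
  have h3 : affineEnd m (s * n) 0 = affineEnd m s 0 := congrArg (fun e => e 0) h2
  have h4 : (Multiplicative.toAdd (s * n).left).map (Int.castRingHom (ZMod m)) =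
      (Multiplicative.toAdd s.left).map (Int.castRingHom (ZMod m)) := by
    have key : ∀ x : Gp, affineEnd m x 0 =
        (Multiplicative.toAdd x.left).map (Int.castRingHom (ZMod m)) := by
      intro x
      show (Multiplicative.toAdd x.left).map (Int.castRingHom (ZMod m)) +
        (x.right : Mat).map (Int.castRingHom (ZMod m)) * 0 = _
      rw [mul_zero, add_zero]
    exact (key _).symm.trans (h3.trans (key _))
  intro i j
  have h5 := congrFun (congrFun h4 i) j
  simp only [Matrix.map_apply, eq_intCast] at h5
  exact (ZMod.intCast_eq_intCast_iff_dvd_sub _ _ m).1 h5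
end

section
/- Let A = M₂(ℤ) be the additive group of 2×2 integer matrices, let SL₂(ℤ) act on A by left matrix multiplication, and let G = A ⋊ SL₂(ℤ) be the corresponding semidirect product. Let H = {(0, h) : h ∈ SL₂(ℤ)} ≤ G, let i = (I, 1) ∈ G where I is the identity matrix, and let K = iHi⁻¹. Then the set {(a, h) ∈ G : det(a) = 1} is separable in G, this set equals the double coset HiH, and consequently the double coset HK = {h₁k : h₁ ∈ H, k ∈ K} = (HiH)i⁻¹ is separable in G. -/
open Pointwise

theorem left_mul_toAdd (x y : Gp) :
    Multiplicative.toAdd (x * y).left =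
      Multiplicative.toAdd x.left + (x.right : Mat) * Multiplicative.toAdd y.left := rfl

/-- Reduction modulo `n` of integer matrices. -/
def redMod (n : ℕ) : Mat →+* Matrix (Fin 2) (Fin 2) (ZMod n) :=
  (Int.castRingHom (ZMod n)).mapMatrix

/-- The affine action of `G` on `M₂(ℤ/n)`. -/
def affEnd (n : ℕ) : Gp →* Function.End (Matrix (Fin 2) (Fin 2) (ZMod n)) where
  toFun x := fun v => redMod n (Multiplicative.toAdd x.left) + redMod n (x.right : Mat) * v
  map_one' := by
    funext v
    show redMod n 0 + redMod n ((1 : SL2) : Mat) * v = v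
    rw [Matrix.SpecialLinearGroup.coe_one, map_zero, map_one, zero_add, one_mul]
  map_mul' x y := by
    funext v
    show redMod n (Multiplicative.toAdd (x * y).left) +
        redMod n ((x.right * y.right : SL2) : Mat) * v =
      redMod n (Multiplicative.toAdd x.left) + redMod n (x.right : Mat) *
        (redMod n (Multiplicative.toAdd y.left) + redMod n (y.right : Mat) * v)
    rw [left_mul_toAdd, Matrix.SpecialLinearGroup.coe_mul, map_add, map_mul, map_mul, mul_add,
      mul_assoc, add_assoc]

theorem det_redMod (n : ℕ) (a : Mat) : (redMod n a).det = ((a.det : ℤ) : ZMod n) :=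
  ((Int.castRingHom (ZMod n)).map_det a).symm

theorem closed_det : ProfinitelyClosed {x : Gp | (Multiplicative.toAdd x.left).det = 1} := by
  intro g hg
  set d : ℤ := (Multiplicative.toAdd g.left).det with hd
  have hd1 : d - 1 ≠ 0 := fun h => hg (by show d = 1; omega)
  let n : ℕ := (d - 1).natAbs + 1
  have : NeZero n := ⟨Nat.succ_ne_zero _⟩
  refine ⟨(affEnd n).toHomPerm.ker, inferInstance, inferInstance, ?_⟩
  rintro ⟨s, hs, m, hm, hsm⟩
  have hm' : (affEnd n).toHomPerm m = 1 := hm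
  have h1 : affEnd n m 0 = 0 := congrArg (fun p => p 0) hm'
  have h2 : affEnd n g 0 = affEnd n s 0 := by
    rw [← hsm]
    show affEnd n (s * m) 0 = _
    rw [map_mul]
    show affEnd n s (affEnd n m 0) = _
    rw [h1]
  have h0 : ∀ x : Gp, affEnd n x 0 = redMod n (Multiplicative.toAdd x.left) := by
    intro x
    show redMod n (Multiplicative.toAdd x.left) + redMod n (x.right : Mat) * 0 = _
    rw [mul_zero, add_zero]
  rw [h0, h0] at h2
  have h3 := congrArg Matrix.det h2
  have hs' : (Multiplicative.toAdd s.left).det = 1 := hs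
  rw [det_redMod, det_redMod, hs', ← hd] at h3
  have h4 : ((d - 1 : ℤ) : ZMod n) = 0 := by
    push_cast at h3 ⊢
    rw [h3, sub_self]
  rw [ZMod.intCast_zmod_eq_zero_iff_dvd] at h4
  have h5 := Nat.le_of_dvd (by omega) (Int.natCast_dvd.mp h4)
  simp only [n] at h5
  omega

theorem det_eq_HiH : {x : Gp | (Multiplicative.toAdd x.left).det = 1} =
      (Hsub : Set Gp) * {iElt} * (Hsub : Set Gp) := by
  ext x
  constructor
  · intro hx
    let h : SL2 := ⟨Multiplicative.toAdd x.left, hx⟩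
    refine ⟨_, ⟨SemidirectProduct.inr h, ⟨h, rfl⟩, iElt, rfl, rfl⟩,
      SemidirectProduct.inr (h⁻¹ * x.right), ⟨_, rfl⟩, ?_⟩
    apply SemidirectProduct.ext
    · show (0 + (h : Mat) * 1) + _ * (0 : Mat) = Multiplicative.toAdd x.left
      rw [mul_zero, add_zero, zero_add, mul_one]
    · show (h * 1) * (h⁻¹ * x.right) = x.right
      group
  · rintro ⟨_, ⟨_, ⟨h, rfl⟩, _, rfl, rfl⟩, _, ⟨k, rfl⟩, rfl⟩
    show ((0 + (h : Mat) * 1) + ((h * 1 : SL2) : Mat) * (0 : Mat)).det = 1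
    rw [mul_zero, add_zero, zero_add, mul_one]
    exact h.2

theorem HK_eq : (Hsub : Set Gp) * (Ksub : Set Gp) =
      ((Hsub : Set Gp) * {iElt} * (Hsub : Set Gp)) * {iElt⁻¹} := by
  have : (Ksub : Set Gp) = {iElt} * (Hsub : Set Gp) * {iElt⁻¹} := by
    ext x
    constructor
    · rintro ⟨h, hh, rfl⟩
      exact ⟨_, ⟨iElt, rfl, h, hh, rfl⟩, _, rfl, rfl⟩
    · rintro ⟨_, ⟨_, rfl, h, hh, rfl⟩, _, rfl, rfl⟩
      exact ⟨h, hh, rfl⟩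
  rw [this]
  simp only [mul_assoc]

theorem closed_mul_right {G : Type*} [Group G] {S : Set G} (hS : ProfinitelyClosed S) (t : G) :
    ProfinitelyClosed (S * {t}) := by
  intro g hg
  obtain ⟨N, hN, hf, h⟩ := hS (g * t⁻¹) (fun hh => hg ⟨_, hh, t, rfl, by simp⟩)
  refine ⟨N, hN, hf, ?_⟩
  rintro ⟨_, ⟨s, hs, t', ht, rfl⟩, m, hm, rfl⟩
  obtain rfl : t' = t := ht
  exact h ⟨s, hs, _, hN.conj_mem m hm t', by simp [mul_assoc]⟩

/-- In `G = M₂(ℤ) ⋊ SL₂(ℤ)`, the set `{(a, h) ∈ G : det a = 1}` is separable, it equals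
the double coset `HiH`, and consequently `HK = (HiH)i⁻¹` is separable in `G`, where
`H = {(0, h) : h ∈ SL₂(ℤ)}`, `i = (I, 1)` and `K = iHi⁻¹`. -/
theorem double_coset_HK_separable :
    ProfinitelyClosed {x : Gp | (Multiplicative.toAdd x.left).det = 1} ∧
    {x : Gp | (Multiplicative.toAdd x.left).det = 1} =
      (Hsub : Set Gp) * {iElt} * (Hsub : Set Gp) ∧
    (Hsub : Set Gp) * (Ksub : Set Gp) =
      ((Hsub : Set Gp) * {iElt} * (Hsub : Set Gp)) * {iElt⁻¹} ∧
    ProfinitelyClosed ((Hsub : Set Gp) * (Ksub : Set Gp)) := by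
  refine ⟨closed_det, det_eq_HiH, HK_eq, ?_⟩
  rw [HK_eq, ← det_eq_HiH]
  exact closed_mul_right closed_det _
end

section
/- Let A = M₂(ℤ) be the additive group of 2×2 integer matrices, let SL₂(ℤ) act on A by left matrix multiplication, and let G = A ⋊ SL₂(ℤ) be the corresponding semidirect product. Let H = {(0, h) : h ∈ SL₂(ℤ)} ≤ G, let i = (I, 1) ∈ G where I is the identity matrix, and let K = iHi⁻¹. Suppose H₀ ≤ SL₂(ℤ) is a subgroup such that the subset {h·I : h ∈ H₀} ⊆ M₂(ℤ) (i.e., H₀ regarded as a set of matrices) is NOT separable in the additive group M₂(ℤ). Then, writing H' = {(0, h) : h ∈ H₀} ≤ G, the double coset H'K = {h'k : h' ∈ H', k ∈ K} is not separable in G. -/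
open Pointwise

/-- A subset `S` of an additive group `A` is *separable* (closed in the profinite
topology on `A`) if for every `a ∉ S` there is a finite-index subgroup `N ≤ A`
with `a ∉ S + N`. -/
def AddProfinitelyClosed {A : Type*} [AddCommGroup A] (S : Set A) : Prop :=
  ∀ a : A, a ∉ S → ∃ N : AddSubgroup A, N.FiniteIndex ∧ a ∉ S + (N : Set A)

/-- If `H₀ ≤ SL₂(ℤ)`, viewed as a set of matrices inside `M₂(ℤ)`, is not separable in
the additive group `M₂(ℤ)`, then the double coset `H'K` is not separable in
`G = M₂(ℤ) ⋊ SL₂(ℤ)`, where `H' = {(0, h) : h ∈ H₀}` and `K = iHi⁻¹`. -/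
theorem not_separable_H'K (H₀ : Subgroup SL2)
    (h : ¬ AddProfinitelyClosed {a : Mat | ∃ h₀ ∈ H₀, a = (h₀ : Mat) * (1 : Mat)}) :
    ¬ ProfinitelyClosed
        (((H₀.map (SemidirectProduct.inr (φ := leftMulAction)) : Subgroup Gp) : Set Gp) *
          (Ksub : Set Gp)) := by
  intro hc
  apply h
  have act : ∀ (g : SL2) (x : Multiplicative Mat),
      leftMulAction g x = Multiplicative.ofAdd ((g : Mat) * x.toAdd) := fun _ _ => rfl
  -- explicit form of the elements of the double coset
  have key : ∀ g k : SL2,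
      (SemidirectProduct.inr g : Gp) * (iElt * SemidirectProduct.inr k * iElt⁻¹) =
        ⟨Multiplicative.ofAdd ((g : Mat) - (g : Mat) * (k : Mat)), g * k⟩ := by
    intro g k
    ext1
    · apply Multiplicative.toAdd.injective
      simp [iElt, act, mul_add, sub_eq_add_neg]
    · simp [iElt]
  intro a ha
  obtain ⟨N, hN, hfin, hg⟩ := hc (⟨Multiplicative.ofAdd (a - 1), 1⟩ : Gp) (by
    rintro ⟨_, ⟨g, hg, rfl⟩, _, ⟨_, ⟨k, rfl⟩, rfl⟩, he⟩
    apply ha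
    refine ⟨g, hg, ?_⟩
    have he' := (key g k).symm.trans he
    have h1 := congrArg SemidirectProduct.left he'
    have h2 := congrArg SemidirectProduct.right he'
    have h1' : (g : Mat) - (g : Mat) * (k : Mat) = a - 1 := h1
    have h2' : (g : Mat) * (k : Mat) = 1 := congrArg (fun x : SL2 => (x : Mat)) h2
    rw [h2'] at h1'
    rw [mul_one]
    exact (sub_left_injective h1').symm)
  let M : Subgroup (Multiplicative Mat) := N.comap SemidirectProduct.inl
  have hM : M.FiniteIndex := by
    refine ⟨?_⟩
    rw [Subgroup.index_comap]
    exact (Subgroup.instFiniteIndex_subgroupOf N _).index_ne_zero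
  refine ⟨Subgroup.toAddSubgroup' M, ⟨hM.index_ne_zero⟩, ?_⟩
  rintro ⟨_, ⟨g, hg₀, rfl⟩, m, hm, rfl⟩
  apply hg
  refine ⟨_, ⟨_, ⟨g, hg₀, rfl⟩, _, ⟨_, ⟨g⁻¹, rfl⟩, rfl⟩, rfl⟩,
    SemidirectProduct.inl (Multiplicative.ofAdd m), hm, ?_⟩
  refine (congrArg (· * SemidirectProduct.inl (Multiplicative.ofAdd m)) (key g g⁻¹)).trans ?_
  have h1 : (g : Mat) * ((g⁻¹ : SL2) : Mat) = 1 := by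
    rw [← Matrix.SpecialLinearGroup.coe_mul, mul_inv_cancel, Matrix.SpecialLinearGroup.coe_one]
  rw [h1, mul_inv_cancel]
  ext1
  · apply Multiplicative.toAdd.injective
    simp only [SemidirectProduct.mul_left, SemidirectProduct.left_inl, map_one, MulAut.one_apply,
      toAdd_mul, toAdd_ofAdd, mul_one]
    abel
  · exact one_mul 1
end
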